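/- arXiv:1305.4260 — 2 statements merged into one kernel-verified Lean document; each statement's English description precedes it below -/
import Mathlib

section
/- Let A ∈ T^{n×n} with ρ(A) = 0 and suppose that every strongly connected component of G(A) contains a node of the critical graph G_c(A). Then A is torsion: there exist k ≥ 1 and c ≥ 1 with A^{⊙(k+c)} = A^{⊙k}. -/
/-- The max-plus (tropical) semiring `T = ℝ ∪ {-∞}`. -/
abbrev T : Type := WithBot ℝ

/-- Tropical matrix product. -/
noncomputable def tmul {n m k : ℕ} (A : Fin n → Fin m → T) (B : Fin m → Fin k → T) :
    Fin n → Fin k → T :=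
  fun i j => Finset.univ.sup fun l => A i l + B l j

/-- Tropical matrix-vector product. -/
noncomputable def tmulVec {n m : ℕ} (A : Fin n → Fin m → T) (u : Fin m → T) : Fin n → T :=
  fun i => Finset.univ.sup fun j => A i j + u j

/-- Tropical identity matrix. -/
noncomputable def tId (n : ℕ) : Fin n → Fin n → T :=
  fun i j => if i = j then (0 : T) else ⊥

/-- Tropical matrix powers. -/
noncomputable def tpow {n : ℕ} (A : Fin n → Fin n → T) : ℕ → (Fin n → Fin n → T)
  | 0 => tId n
  | (m + 1) => tmul (tpow A m) A

/-- Tropical product of a list of matrices (empty product = identity). -/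
noncomputable def tProd {n : ℕ} : List (Fin n → Fin n → T) → (Fin n → Fin n → T)
  | [] => tId n
  | (M :: L) => tmul M (tProd L)

/-- Weight of a permutation. -/
noncomputable def wt {n : ℕ} (A : Fin n → Fin n → T) (σ : Equiv.Perm (Fin n)) : T :=
  ∑ i, A i (σ i)

/-- Tropical permanent. -/
noncomputable def per {n : ℕ} (A : Fin n → Fin n → T) : T :=
  Finset.univ.sup fun σ : Equiv.Perm (Fin n) => wt A σ

/-- Tropical non-singularity: finite permanent attained by a unique permutation. -/
def NonSingular {n : ℕ} (A : Fin n → Fin n → T) : Prop :=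
  per A ≠ ⊥ ∧ ∃! σ : Equiv.Perm (Fin n), wt A σ = per A

/-- Weight of the circuit `c 0 → c 1 → ⋯ → c ℓ → c 0` (length `ℓ+1`). -/
noncomputable def cwt {n ℓ : ℕ} (A : Fin n → Fin n → T) (c : Fin (ℓ + 1) → Fin n) : T :=
  ∑ k : Fin (ℓ + 1), A (c k) (c (k + 1))

/-- `ρ(A) = r`: some circuit has mean weight `r`, and every circuit has mean weight `≤ r`. -/
def RhoEq {n : ℕ} (A : Fin n → Fin n → T) (r : ℝ) : Prop :=
  (∃ ℓ, ∃ c : Fin (ℓ + 1) → Fin n, cwt A c = ((((ℓ : ℝ) + 1) * r : ℝ) : T)) ∧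
  ∀ ℓ, ∀ c : Fin (ℓ + 1) → Fin n, cwt A c ≤ ((((ℓ : ℝ) + 1) * r : ℝ) : T)

/-- `(i,j)` is an arc of the critical graph (lies on a circuit of mean weight `r = ρ(A)`). -/
def CritArc {n : ℕ} (A : Fin n → Fin n → T) (r : ℝ) (i j : Fin n) : Prop :=
  ∃ ℓ, ∃ c : Fin (ℓ + 1) → Fin n, cwt A c = ((((ℓ : ℝ) + 1) * r : ℝ) : T) ∧
    ∃ k : Fin (ℓ + 1), c k = i ∧ c (k + 1) = j

/-- `i` is a node of the critical graph. -/
def CritNode {n : ℕ} (A : Fin n → Fin n → T) (r : ℝ) (i : Fin n) : Prop :=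
  ∃ ℓ, ∃ c : Fin (ℓ + 1) → Fin n, cwt A c = ((((ℓ : ℝ) + 1) * r : ℝ) : T) ∧
    ∃ k : Fin (ℓ + 1), c k = i

/-- Reachability in the critical graph. -/
def CritReach {n : ℕ} (A : Fin n → Fin n → T) (r : ℝ) : Fin n → Fin n → Prop :=
  Relation.ReflTransGen (fun i j => CritArc A r i j)

/-- Same strongly connected component of the critical graph. -/
def SameScc {n : ℕ} (A : Fin n → Fin n → T) (r : ℝ) (i j : Fin n) : Prop :=
  CritReach A r i j ∧ CritReach A r j i

/-- `R` is a set of representatives, one per scc of the critical graph. -/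
def SccReps {n : ℕ} (A : Fin n → Fin n → T) (r : ℝ) (R : Finset (Fin n)) : Prop :=
  (∀ i ∈ R, CritNode A r i) ∧
  (∀ i ∈ R, ∀ j ∈ R, i ≠ j → ¬ SameScc A r i j) ∧
  (∀ j, CritNode A r j → ∃ i ∈ R, SameScc A r i j)

/-- Cyclicity of the scc of the critical graph containing `i`:
the gcd (greatest common divisor) of the lengths of the critical circuits through `i`. -/
noncomputable def cycAt {n : ℕ} (A : Fin n → Fin n → T) (r : ℝ) (i : Fin n) : ℕ :=
  sSup {d : ℕ | ∀ ℓ : ℕ,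
    (∃ c : Fin (ℓ + 1) → Fin n, cwt A c = ((((ℓ : ℝ) + 1) * r : ℝ) : T) ∧ c 0 = i) →
    d ∣ (ℓ + 1)}

/-- `A` has an `r × r` tropically non-singular submatrix. -/
def HasNSsub {n m : ℕ} (A : Fin n → Fin m → T) (r : ℕ) : Prop :=
  ∃ f : Fin r → Fin n, ∃ g : Fin r → Fin m,
    Function.Injective f ∧ Function.Injective g ∧
    NonSingular (fun i j => A (f i) (g j))

/-- Tropical rank: maximal size of a tropically non-singular square submatrix. -/
noncomputable def trrk {n m : ℕ} (A : Fin n → Fin m → T) : ℕ :=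
  sSup {r : ℕ | HasNSsub A r}

/-- Tropical convex hull (span) of a finite family of vectors of `T^n`. -/
def tSpan {n m : ℕ} (v : Fin m → (Fin n → T)) : Set (Fin n → T) :=
  { w | ∃ α : Fin m → T, w = fun i => Finset.univ.sup fun j => α j + v j i }

/-- Weak dimension of a tropically convex set: minimal size of a generating family. -/
noncomputable def weakDim {n : ℕ} (X : Set (Fin n → T)) : ℕ :=
  sInf {k : ℕ | ∃ v : Fin k → (Fin n → T), tSpan v = X}

/-- Column rank: weak dimension of the tropical convex hull of the columns. -/
noncomputable def colrk {n m : ℕ} (A : Fin n → Fin m → T) : ℕ :=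
  weakDim (tSpan fun j => fun i => A i j)

/-- Row rank: weak dimension of the tropical convex hull of the rows. -/
noncomputable def rowrk {n m : ℕ} (A : Fin n → Fin m → T) : ℕ :=
  weakDim (tSpan fun i => fun j => A i j)

/-- Weight of the stretch of the walk `f` between the times `a` and `b`. -/
noncomputable def walkWeight {n : ℕ} (A : Fin n → Fin n → T) (f : ℕ → Fin n) (a b : ℕ) : T :=
  ∑ t ∈ Finset.Ico a b, A (f t) (f (t + 1))

section Walks

variable {n : ℕ} (A : Fin n → Fin n → T)

theorem walkWeight_zero_le_tpow (f : ℕ → Fin n) (m : ℕ) :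
    walkWeight A f 0 m ≤ tpow A m (f 0) (f m) := by
  induction m with
  | zero => simp [walkWeight, tpow, tId]
  | succ m ih =>
    have h : walkWeight A f 0 (m + 1) = walkWeight A f 0 m + A (f m) (f (m + 1)) := by
      simp [walkWeight, Finset.sum_range_succ]
    rw [h]
    exact (add_le_add_left ih _).trans
      (Finset.le_sup (f := fun l => tpow A m (f 0) l + A l (f (m + 1))) (Finset.mem_univ (f m)))

theorem walkWeight_le_tpow (f : ℕ → Fin n) {a b : ℕ} (hab : a ≤ b) :
    walkWeight A f a b ≤ tpow A (b - a) (f a) (f b) := by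
  have h := walkWeight_zero_le_tpow A (fun t => f (a + t)) (b - a)
  have e : walkWeight A (fun t => f (a + t)) 0 (b - a) = walkWeight A f a b := by
    simp only [walkWeight]
    rw [Finset.sum_Ico_eq_sum_range _ a b, Finset.range_eq_Ico]
    rfl
  simpa [e, Nat.add_sub_cancel' hab] using h

theorem walkWeight_add (f : ℕ → Fin n) {a b c : ℕ} (hab : a ≤ b) (hbc : b ≤ c) :
    walkWeight A f a b + walkWeight A f b c = walkWeight A f a c :=
  Finset.sum_Ico_consecutive _ hab hbc

theorem exists_walkWeight_eq_tpow (m : ℕ) (i k : Fin n) (h : tpow A m i k ≠ ⊥) :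
    ∃ f : ℕ → Fin n, f 0 = i ∧ f m = k ∧ walkWeight A f 0 m = tpow A m i k := by
  induction m generalizing k with
  | zero =>
    have hik : i = k := by
      by_contra hne
      exact h (by simp [tpow, tId, hne])
    exact ⟨fun _ => i, rfl, hik, by simp [walkWeight, tpow, tId, hik]⟩
  | succ m ih =>
    obtain ⟨l, -, hl⟩ := Finset.exists_mem_eq_sup Finset.univ ⟨i, Finset.mem_univ i⟩
      (fun l => tpow A m i l + A l k)
    change tpow A (m + 1) i k = tpow A m i l + A l k at hl
    have hne : tpow A m i l ≠ ⊥ := by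
      intro hb
      exact h (by rw [hl, hb, WithBot.bot_add])
    obtain ⟨f, hf0, hfm, hfw⟩ := ih l hne
    refine ⟨fun t => if t ≤ m then f t else k, by simp [hf0], by simp, ?_⟩
    rw [hl, ← hfw, ← hfm]
    simp only [walkWeight, Finset.sum_Ico_succ_top (Nat.zero_le m)]
    congr 1
    · refine Finset.sum_congr rfl fun t ht => ?_
      have := (Finset.mem_Ico.1 ht).2
      rw [if_pos (by omega), if_pos (by omega)]
    · simp

theorem tpow_add_le (a b : ℕ) (i j k : Fin n) :
    tpow A a i j + tpow A b j k ≤ tpow A (a + b) i k := by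
  by_cases ha : tpow A a i j = ⊥
  · simp [ha]
  by_cases hb : tpow A b j k = ⊥
  · simp [hb]
  obtain ⟨f, hf0, hfa, hfw⟩ := exists_walkWeight_eq_tpow A a i j ha
  obtain ⟨g, hg0, hgb, hgw⟩ := exists_walkWeight_eq_tpow A b j k hb
  set h : ℕ → Fin n := fun t => if t ≤ a then f t else g (t - a) with hh
  have h_shift : ∀ t, h (a + t) = g t := by
    intro t
    rcases Nat.eq_zero_or_pos t with rfl | ht
    · simp [hh, hfa, hg0]
    · simp only [hh]
      rw [if_neg (by omega), Nat.add_sub_cancel_left]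
  have h1 : walkWeight A h 0 a = walkWeight A f 0 a := by
    refine Finset.sum_congr rfl fun t ht => ?_
    have := (Finset.mem_Ico.1 ht).2
    simp only [hh]
    rw [if_pos (by omega), if_pos (by omega)]
  have h2 : walkWeight A h a (a + b) = walkWeight A g 0 b := by
    simp only [walkWeight]
    rw [Finset.sum_Ico_eq_sum_range, Nat.add_sub_cancel_left, Finset.range_eq_Ico]
    refine Finset.sum_congr rfl fun t _ => ?_
    rw [add_assoc, h_shift, h_shift]
  have key := walkWeight_zero_le_tpow A h (a + b)
  rw [← walkWeight_add A h (Nat.zero_le a) (Nat.le_add_right a b), h1, h2, hfw, hgw,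
    h_shift, hgb] at key
  simpa [hh, hf0] using key

/-- A long enough optimal walk, sampled at multiples of `p`, revisits some node. -/
theorem exists_tpow_le_add_circuit (p m : ℕ) (i k : Fin n) (hm : n * p ≤ m) :
    ∃ s t : ℕ, s < t ∧ t ≤ n ∧ ∃ x : Fin n, tpow A m i k ≤
      tpow A (s * p) i x + tpow A ((t - s) * p) x x + tpow A (m - t * p) x k := by
  by_cases hb : tpow A m i k = ⊥
  · exact ⟨0, 1, one_pos, i.pos, i, by simp [hb]⟩
  obtain ⟨f, hf0, hfm, hfw⟩ := exists_walkWeight_eq_tpow A m i k hb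
  obtain ⟨s, t, hne, hst⟩ := Fintype.exists_ne_map_eq_of_card_lt
    (fun s : Fin (n + 1) => f (s.val * p)) (by simp)
  wlog hlt : s < t generalizing s t
  · exact this t s hne.symm hst.symm (lt_of_le_of_ne (not_lt.1 hlt) hne.symm)
  have hlt' : s.val < t.val := hlt
  have htn : t.val ≤ n := Nat.lt_succ_iff.1 t.2
  have hsp : s.val * p ≤ t.val * p := Nat.mul_le_mul_right p hlt'.le
  have htp : t.val * p ≤ m := (Nat.mul_le_mul_right p htn).trans hm
  refine ⟨s, t, hlt', htn, f (s.val * p), ?_⟩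
  rw [← hfw, ← walkWeight_add A f (Nat.zero_le _) htp,
    ← walkWeight_add A f (Nat.zero_le _) hsp]
  refine add_le_add (add_le_add ?_ ?_) ?_
  · simpa [hf0] using walkWeight_le_tpow A f (Nat.zero_le (s.val * p))
  · have h := walkWeight_le_tpow A f hsp
    rw [← Nat.sub_mul] at h
    rwa [← hst] at h
  · have h := walkWeight_le_tpow A f htp
    rwa [← hst, hfm] at h

theorem tpow_diag_nonpos (h0 : RhoEq A 0) (a : ℕ) (i : Fin n) : tpow A a i i ≤ 0 := by
  by_cases hb : tpow A a i i = ⊥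
  · simp [hb]
  rcases a with _ | ℓ
  · simp [tpow, tId]
  obtain ⟨f, hf0, hfa, hfw⟩ := exists_walkWeight_eq_tpow A (ℓ + 1) i i hb
  have h := h0.2 ℓ (fun t => f t.val)
  rw [mul_zero, WithBot.coe_zero] at h
  refine le_trans (le_of_eq ?_) h
  rw [← hfw, walkWeight, ← Finset.range_eq_Ico, ← Fin.sum_univ_eq_sum_range
    (fun t => A (f t) (f (t + 1))), cwt]
  refine Finset.sum_congr rfl fun t _ => ?_
  congr 1
  rcases eq_or_ne t (Fin.last ℓ) with rfl | hne
  · simp [hf0, hfa]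
  · rw [Fin.val_add_one, if_neg hne]

theorem CritNode.exists_tpow_diag_nonneg {j : Fin n} (hj : CritNode A 0 j) :
    ∃ a : ℕ, 1 ≤ a ∧ 0 ≤ tpow A a j j := by
  obtain ⟨ℓ, c, hc, k, rfl⟩ := hj
  refine ⟨ℓ + 1, by omega, ?_⟩
  rw [mul_zero, WithBot.coe_zero] at hc
  have h := walkWeight_zero_le_tpow A (fun t => c (k + Fin.ofNat (ℓ + 1) t)) (ℓ + 1)
  have e0 : Fin.ofNat (ℓ + 1) 0 = 0 := rfl
  have e1 : Fin.ofNat (ℓ + 1) (ℓ + 1) = 0 := by ext; simp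
  simp only [e0, e1, add_zero] at h
  refine le_trans (le_of_eq ?_) h
  rw [← hc, cwt, ← Equiv.sum_comp (Equiv.addLeft k), walkWeight, ← Finset.range_eq_Ico,
    ← Fin.sum_univ_eq_sum_range (fun t => A (c (k + Fin.ofNat (ℓ + 1) t))
      (c (k + Fin.ofNat (ℓ + 1) (t + 1))))]
  refine Finset.sum_congr rfl fun t _ => ?_
  have e2 : Fin.ofNat (ℓ + 1) t.val = t := by ext; simp
  have e3 : Fin.ofNat (ℓ + 1) (t.val + 1) = t + 1 := by
    ext
    simp [Fin.val_add]
  rw [e2, e3, Equiv.coe_addLeft, add_assoc]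

theorem tpow_mul_diag_nonneg {a : ℕ} {j : Fin n} (h : 0 ≤ tpow A a j j) (t : ℕ) :
    0 ≤ tpow A (t * a) j j := by
  induction t with
  | zero => simp [tpow, tId]
  | succ t ih =>
    rw [Nat.succ_mul]
    exact (add_nonneg ih h).trans (tpow_add_le A _ _ j j j)

/-- A common length at which every node on a circuit of nonnegative weight has a closed walk of
nonnegative weight. -/
theorem exists_common_period : ∃ p : ℕ, 1 ≤ p ∧
    ∀ j : Fin n, (∃ a : ℕ, 1 ≤ a ∧ 0 ≤ tpow A a j j) → 0 ≤ tpow A p j j := by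
  classical
  have h : ∀ j : Fin n, ∃ a : ℕ, 1 ≤ a ∧
      ((∃ a : ℕ, 1 ≤ a ∧ 0 ≤ tpow A a j j) → 0 ≤ tpow A a j j) := by
    intro j
    by_cases hj : ∃ a : ℕ, 1 ≤ a ∧ 0 ≤ tpow A a j j
    · obtain ⟨a, ha, h⟩ := hj
      exact ⟨a, ha, fun _ => h⟩
    · exact ⟨1, le_rfl, fun h => absurd h hj⟩
  choose a ha hpos using h
  refine ⟨∏ j, a j, Nat.one_le_iff_ne_zero.2
    (Finset.prod_ne_zero_iff.2 fun j _ => Nat.one_le_iff_ne_zero.1 (ha j)), fun j hj => ?_⟩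
  obtain ⟨q, hq⟩ := Finset.dvd_prod_of_mem a (Finset.mem_univ j)
  rw [hq, mul_comm]
  exact tpow_mul_diag_nonneg A (hpos j hj) q

theorem tpow_le_tpow_add_mul {p : ℕ} {i k : Fin n}
    (h : 0 ≤ tpow A p i i ∨ 0 ≤ tpow A p k k) (m t : ℕ) :
    tpow A m i k ≤ tpow A (m + t * p) i k := by
  rcases h with h | h
  · rw [add_comm]
    exact (le_add_of_nonneg_left (tpow_mul_diag_nonneg A h t)).trans (tpow_add_le A _ _ i i k)
  · exact (le_add_of_nonneg_right (tpow_mul_diag_nonneg A h t)).trans (tpow_add_le A _ _ i k k)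

theorem tpow_add_period_le (h0 : RhoEq A 0) {p : ℕ} {i k : Fin n}
    (h : 0 ≤ tpow A p i i ∨ 0 ≤ tpow A p k k) {m : ℕ} (hm : n * p ≤ m) :
    tpow A (m + p) i k ≤ tpow A m i k := by
  obtain ⟨s, t, hst, htn, x, hx⟩ :=
    exists_tpow_le_add_circuit A p (m + p) i k (hm.trans (Nat.le_add_right m p))
  have htp : t * p ≤ m := (Nat.mul_le_mul_right p htn).trans hm
  obtain ⟨d, rfl⟩ : ∃ d, t = s + d + 1 := ⟨t - s - 1, by omega⟩
  calc tpow A (m + p) i k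
      ≤ tpow A (s * p) i x + 0 + tpow A (m + p - (s + d + 1) * p) x k :=
        hx.trans (by gcongr; exact tpow_diag_nonpos A h0 _ x)
    _ ≤ tpow A (s * p + (m + p - (s + d + 1) * p)) i k := by
        rw [add_zero]; exact tpow_add_le A _ _ i x k
    _ ≤ tpow A (s * p + (m + p - (s + d + 1) * p) + d * p) i k :=
        tpow_le_tpow_add_mul A h _ d
    _ = tpow A m i k := by
        congr 1
        have : (s + d + 1) * p = s * p + d * p + p := by ring
        omega

/-- If all circuits have negative weight, the powers tend to `-∞`. -/
theorem eventually_tpow_lt (hneg : ∀ a : ℕ, 1 ≤ a → ∀ i : Fin n, tpow A a i i < 0)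
    (i k : Fin n) (K : T) (hK : K ≠ ⊥) : ∀ᶠ m in Filter.atTop, tpow A m i k < K := by
  have hn : (0 : ℝ) < n := by exact_mod_cast i.pos
  obtain ⟨ε, hε, hcirc⟩ : ∃ ε : ℝ, 0 < ε ∧
      ∀ a, 1 ≤ a → a ≤ n → ∀ x : Fin n, tpow A a x x ≤ ((-(ε * n) : ℝ) : T) := by
    have hlt : ((Finset.Icc 1 n ×ˢ Finset.univ).sup
        fun q : ℕ × Fin n => tpow A q.1 q.2 q.2) < 0 := by
      refine (Finset.sup_lt_iff (WithBot.bot_lt_coe (0 : ℝ))).2 ?_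
      rintro ⟨a, x⟩ hq
      exact hneg a (Finset.mem_Icc.1 (Finset.mem_product.1 hq).1).1 x
    obtain ⟨c, hc1, hc2⟩ := exists_between hlt
    obtain ⟨r, rfl⟩ := WithBot.ne_bot_iff_exists.1 (ne_bot_of_gt hc1)
    have hr : r < 0 := by exact_mod_cast hc2
    refine ⟨-r / n, div_pos (neg_pos.2 hr) hn, fun a h1 h2 x => ?_⟩
    rw [div_mul_cancel₀ _ hn.ne', neg_neg]
    exact (Finset.le_sup (f := fun q : ℕ × Fin n => tpow A q.1 q.2 q.2)
      (b := (a, x)) (by simp [h1, h2])).trans hc1.le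
  obtain ⟨C, hC⟩ : ∃ C : ℝ, ∀ m < n, tpow A m i k ≤ (C : T) := by
    obtain ⟨C, hC⟩ : ∃ C : ℝ, ((Finset.range n).sup fun m => tpow A m i k) ≤ (C : T) := by
      generalize ((Finset.range n).sup fun m => tpow A m i k) = y
      by_cases hy : y = ⊥
      · exact ⟨0, hy ▸ bot_le⟩
      · obtain ⟨C, rfl⟩ := WithBot.ne_bot_iff_exists.1 hy
        exact ⟨C, le_rfl⟩
    exact ⟨C, fun m hm =>
      (Finset.le_sup (f := fun m => tpow A m i k) (Finset.mem_range.2 hm)).trans hC⟩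
  have hbound : ∀ m : ℕ, tpow A m i k ≤ ((C + ε * n - ε * m : ℝ) : T) := by
    intro m
    induction m using Nat.strong_induction_on with
    | _ m ih =>
      rcases lt_or_ge m n with hm | hm
      · refine (hC m hm).trans (WithBot.coe_le_coe.2 ?_)
        have : (m : ℝ) ≤ n := by exact_mod_cast hm.le
        nlinarith
      · obtain ⟨s, t, hst, htn, x, hx⟩ :=
          exists_tpow_le_add_circuit A 1 m i k (by simpa using hm)
        simp only [mul_one] at hx
        calc tpow A m i k
            ≤ tpow A s i x + ((-(ε * n) : ℝ) : T) + tpow A (m - t) x k :=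
              hx.trans (by gcongr; exact hcirc _ (by omega) (by omega) x)
          _ = ((-(ε * n) : ℝ) : T) + (tpow A s i x + tpow A (m - t) x k) := by
              rw [add_comm (tpow A s i x), add_assoc]
          _ ≤ ((-(ε * n) : ℝ) : T) + tpow A (s + (m - t)) i k := by
              gcongr; exact tpow_add_le A _ _ i x k
          _ ≤ ((-(ε * n) : ℝ) : T) + ((C + ε * n - ε * (s + (m - t) : ℕ) : ℝ) : T) := by
              gcongr; exact ih _ (by omega)
          _ ≤ ((C + ε * n - ε * m : ℝ) : T) := by
              rw [← WithBot.coe_add, WithBot.coe_le_coe]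
              have : (m : ℝ) ≤ n + (s + (m - t) : ℕ) := by
                exact_mod_cast (by omega : m ≤ n + (s + (m - t)))
              nlinarith
  obtain ⟨r, rfl⟩ := WithBot.ne_bot_iff_exists.1 hK
  have hlim : Filter.Tendsto (fun m : ℕ => ε * (m : ℝ)) Filter.atTop Filter.atTop :=
    tendsto_natCast_atTop_atTop.const_mul_atTop hε
  filter_upwards [hlim.eventually_gt_atTop (C + ε * n - r)] with m hm
  exact (hbound m).trans_lt (WithBot.coe_lt_coe.2 (by linarith))

/-- For large `m`, optimal walks of length `m` whose weight is bounded below meet every set `S`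
containing all nodes on circuits of nonnegative weight. -/
theorem eventually_exists_mem_split (S : Set (Fin n))
    (hS : ∀ j a, 1 ≤ a → 0 ≤ tpow A a j j → j ∈ S) (i k : Fin n) (K : T) (hK : K ≠ ⊥) :
    ∀ᶠ m in Filter.atTop, K ≤ tpow A m i k → ∃ j ∈ S, ∃ a b : ℕ, a + b = m ∧
      tpow A m i k ≤ tpow A a i j + tpow A b j k := by
  classical
  set B : Fin n → Fin n → T := fun x y => if x ∈ S then ⊥ else A x y with hB
  have hBA : ∀ f a b, walkWeight B f a b ≤ walkWeight A f a b := fun f a b =>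
    Finset.sum_le_sum fun t _ => by
      simp only [hB]
      split_ifs <;> simp
  have hneg : ∀ a : ℕ, 1 ≤ a → ∀ x : Fin n, tpow B a x x < 0 := by
    intro a ha x
    by_cases hb : tpow B a x x = ⊥
    · rw [hb]
      exact WithBot.bot_lt_coe 0
    obtain ⟨f, hf0, hfa, hfw⟩ := exists_walkWeight_eq_tpow B a x x hb
    by_contra hcon
    rw [not_lt] at hcon
    have hxS : x ∈ S := by
      refine hS x a ha (hcon.trans ?_)
      rw [← hfw]
      refine (hBA f 0 a).trans ?_
      simpa [hf0, hfa] using walkWeight_zero_le_tpow A f a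
    apply hb
    rw [← hfw, ← walkWeight_add B f (Nat.zero_le 1) ha]
    simp [walkWeight, hB, hf0, hxS]
  filter_upwards [eventually_tpow_lt B hneg i k K hK] with m hlt hle
  have hb : tpow A m i k ≠ ⊥ := fun hb => hK (le_bot_iff.1 (hb ▸ hle))
  obtain ⟨f, hf0, hfm, hfw⟩ := exists_walkWeight_eq_tpow A m i k hb
  by_cases hmeet : ∃ t < m, f t ∈ S
  · obtain ⟨t, htm, ht⟩ := hmeet
    refine ⟨f t, ht, t, m - t, by omega, ?_⟩
    rw [← hfw, ← walkWeight_add A f (Nat.zero_le t) htm.le]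
    refine add_le_add ?_ ?_
    · simpa [hf0] using walkWeight_zero_le_tpow A f t
    · simpa [hfm] using walkWeight_le_tpow A f htm.le
  · push Not at hmeet
    have e : walkWeight B f 0 m = walkWeight A f 0 m :=
      Finset.sum_congr rfl fun t ht => by
        simp only [hB]
        rw [if_neg (hmeet t (Finset.mem_Ico.1 ht).2)]
    have h := walkWeight_zero_le_tpow B f m
    rw [e, hfw, hf0, hfm] at h
    exact absurd (hle.trans h) (not_le.2 hlt)

/-- Within a residue class modulo `p`, entries reachable through a node with a closed walk of
length `p` and nonnegative weight are eventually bounded below. -/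
theorem exists_lower_bound {p : ℕ} (hp : 1 ≤ p) {i j k : Fin n} (hj : 0 ≤ tpow A p j j)
    {a b m₀ : ℕ} (ha : tpow A a i j ≠ ⊥) (hb : tpow A b j i ≠ ⊥) (hm₀ : tpow A m₀ i k ≠ ⊥) :
    ∃ K : T, K ≠ ⊥ ∧ ∀ᶠ m in Filter.atTop, m % p = m₀ % p → K ≤ tpow A m i k := by
  have hclosed : ∀ t : ℕ, tpow A (t * (b + a)) j j ≠ ⊥ := by
    intro t
    induction t with
    | zero => simp [tpow, tId]
    | succ t ih =>
      rw [Nat.succ_mul]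
      refine ne_bot_of_le_ne_bot ?_ (tpow_add_le A _ _ j j j)
      refine WithBot.add_ne_bot.2 ⟨ih, ne_bot_of_le_ne_bot ?_ (tpow_add_le A _ _ j i j)⟩
      exact WithBot.add_ne_bot.2 ⟨hb, ha⟩
  set c := (p - 1) * (b + a) with hc
  refine ⟨tpow A a i j + (tpow A c j j + (tpow A b j i + tpow A m₀ i k)), ?_, ?_⟩
  · simp only [WithBot.add_ne_bot]
    exact ⟨ha, hclosed _, hb, hm₀⟩
  filter_upwards [Filter.eventually_ge_atTop (a + (c + (b + m₀)))] with m hm hmod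
  have hlen : a + (c + (b + m₀)) = m₀ + p * (b + a) := by
    obtain ⟨q, rfl⟩ : ∃ q, p = q + 1 := ⟨p - 1, by omega⟩
    simp only [hc, Nat.add_sub_cancel]
    ring
  obtain ⟨t, ht⟩ : p ∣ m - (a + (c + (b + m₀))) := by
    apply (Nat.modEq_iff_dvd' hm).1
    rw [hlen]
    simp [Nat.ModEq, hmod]
  calc tpow A a i j + (tpow A c j j + (tpow A b j i + tpow A m₀ i k))
      ≤ tpow A a i j + tpow A (c + (b + m₀)) j k := by
        gcongr
        refine le_trans ?_ (tpow_add_le A _ _ j j k)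
        gcongr
        exact tpow_add_le A _ _ j i k
    _ ≤ tpow A a i j + tpow A (c + (b + m₀) + t * p) j k := by
        gcongr
        exact tpow_le_tpow_add_mul A (Or.inl hj) _ t
    _ ≤ tpow A (a + (c + (b + m₀) + t * p)) i k := tpow_add_le A _ _ i j k
    _ = tpow A m i k := by
        congr 1
        rw [mul_comm t p]
        omega

theorem exists_tpow_ne_bot {i j : Fin n} (h : i = j ∨ ∃ m : ℕ, tpow A (m + 1) i j ≠ ⊥) :
    ∃ m : ℕ, tpow A m i j ≠ ⊥ := by
  rcases h with rfl | ⟨m, hm⟩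
  · exact ⟨0, by simp [tpow, tId]⟩
  · exact ⟨m + 1, hm⟩

end Walks

/-- If `ρ(A) = 0` and every strongly connected component of `G(A)`
contains a critical node, then `A` is torsion. -/
theorem stmt12 {n : ℕ} (A : Fin n → Fin n → T) (h0 : RhoEq A 0)
    (hscc : ∀ i : Fin n, ∃ j : Fin n, CritNode A 0 j ∧
      (i = j ∨ ∃ m : ℕ, tpow A (m + 1) i j ≠ ⊥) ∧
      (j = i ∨ ∃ m : ℕ, tpow A (m + 1) j i ≠ ⊥)) :
    ∃ k : ℕ, 1 ≤ k ∧ ∃ c : ℕ, 1 ≤ c ∧ tpow A (k + c) = tpow A k := by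
  obtain ⟨p, hp, hper⟩ := exists_common_period A
  set S : Set (Fin n) := {j | 0 ≤ tpow A p j j}
  have hS : ∀ j a, 1 ≤ a → 0 ≤ tpow A a j j → j ∈ S := fun j a ha h => hper j ⟨a, ha, h⟩
  have hmain : ∀ (i k : Fin n) (r : Fin p), ∀ᶠ m in Filter.atTop,
      m % p = r.val → tpow A (m + p) i k = tpow A m i k := by
    intro i k r
    by_cases hfin : ∃ m₀, m₀ % p = r.val ∧ tpow A m₀ i k ≠ ⊥
    swap
    · push Not at hfin
      refine Filter.Eventually.of_forall fun m hm => ?_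
      rw [hfin m hm, hfin (m + p) (by simpa using hm)]
    obtain ⟨m₀, hm₀, hne⟩ := hfin
    obtain ⟨j, hj, hij, hji⟩ := hscc i
    obtain ⟨a, ha⟩ := exists_tpow_ne_bot A hij
    obtain ⟨b, hb⟩ := exists_tpow_ne_bot A hji
    obtain ⟨K, hK, hlow⟩ := exists_lower_bound A hp
      (hper j (CritNode.exists_tpow_diag_nonneg A hj)) ha hb hne
    have hsplit := eventually_exists_mem_split A S hS i k K hK
    have hshift := Filter.tendsto_add_atTop_nat p
    filter_upwards [hlow, hsplit, hshift.eventually hlow, hshift.eventually hsplit,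
      Filter.eventually_ge_atTop (2 * (n * p) + p)] with m h1 h2 h3 h4 hm hmod
    apply le_antisymm
    · obtain ⟨x, hx, u, v, huv, hle⟩ := h4 (h3 (by simp [hmod, hm₀]))
      refine hle.trans ?_
      rcases le_or_gt (n * p + p) u with hu | hu
      · obtain ⟨u, rfl⟩ : ∃ w, u = w + p := ⟨u - p, by omega⟩
        calc tpow A (u + p) i x + tpow A v x k
            ≤ tpow A u i x + tpow A v x k := by
              gcongr
              exact tpow_add_period_le A h0 (Or.inr hx) (by omega)
          _ ≤ tpow A (u + v) i k := tpow_add_le A _ _ i x k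
          _ = tpow A m i k := by congr 1; omega
      · obtain ⟨v, rfl⟩ : ∃ w, v = w + p := ⟨v - p, by omega⟩
        calc tpow A u i x + tpow A (v + p) x k
            ≤ tpow A u i x + tpow A v x k := by
              gcongr
              exact tpow_add_period_le A h0 (Or.inl hx) (by omega)
          _ ≤ tpow A (u + v) i k := tpow_add_le A _ _ i x k
          _ = tpow A m i k := by congr 1; omega
    · obtain ⟨x, hx, u, v, huv, hle⟩ := h2 (h1 (by rw [hmod, hm₀]))
      calc tpow A m i k ≤ tpow A u i x + tpow A v x k := hle
        _ ≤ tpow A u i x + tpow A (v + 1 * p) x k := by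
            gcongr
            exact tpow_le_tpow_add_mul A (Or.inl hx) v 1
        _ ≤ tpow A (u + (v + 1 * p)) i k := tpow_add_le A _ _ i x k
        _ = tpow A (m + p) i k := by congr 1; omega
  have hall : ∀ᶠ m in Filter.atTop, ∀ (i k : Fin n) (r : Fin p),
      m % p = r.val → tpow A (m + p) i k = tpow A m i k := by
    simpa only [Filter.eventually_all] using hmain
  obtain ⟨k, hk, hk1⟩ := (hall.and (Filter.eventually_ge_atTop 1)).exists
  refine ⟨k, hk1, p, hp, ?_⟩
  funext x y
  exact hk x y ⟨k % p, Nat.mod_lt k hp⟩ rfl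
end

section
/- (Maximal ultimate rank criterion) For A ∈ T^{n×n}, the ultimate rank of A equals n if and only if the critical graph G_c(A) is the disjoint union of simple circuits covering all nodes {1,…,n}; and in this case per(A) = n·ρ(A) and A has a unique maximizing permutation whose graph equals G_c(A). -/
/-- `RelWalk E m i j`: there is a walk of length `m` from `i` to `j` along the relation `E`. -/
inductive RelWalk {V : Type*} (E : V → V → Prop) : ℕ → V → V → Prop
  | nil (i : V) : RelWalk E 0 i i
  | cons {m : ℕ} {i j k : V} : E i j → RelWalk E m j k → RelWalk E (m + 1) i k

namespace RelWalk

variable {V : Type*} {E : V → V → Prop}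

theorem append {m m' : ℕ} {i j k : V} (h : RelWalk E m i j) (h' : RelWalk E m' j k) :
    RelWalk E (m + m') i k := by
  induction h with
  | nil i => simpa using h'
  | @cons m i j l e _ ih => simpa [Nat.add_right_comm] using cons e (ih h')

theorem single {i j : V} (h : E i j) : RelWalk E 1 i j := cons h (nil j)

theorem of_fun (f : ℕ → V) (s m : ℕ) (h : ∀ k < s + m, E (f k) (f (k + 1))) :
    RelWalk E m (f s) (f (s + m)) := by
  induction m with
  | zero => exact nil _
  | succ m ih =>
    exact (ih fun k hk => h k (by omega)).append (single (h (s + m) (by omega)))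

theorem exists_fun {m : ℕ} {i j : V} (h : RelWalk E m i j) :
    ∃ f : ℕ → V, f 0 = i ∧ f m = j ∧ ∀ k < m, E (f k) (f (k + 1)) := by
  induction h with
  | nil i => exact ⟨fun _ => i, rfl, rfl, by simp⟩
  | @cons m i j k e _ ih =>
    obtain ⟨f, h0, hm, hf⟩ := ih
    refine ⟨fun t => Nat.casesOn t i f, rfl, hm, fun t ht => ?_⟩
    cases t with
    | zero => simpa [h0] using e
    | succ t => exact hf t (by omega)

theorem reflTransGen_iff {i j : V} :
    Relation.ReflTransGen E i j ↔ ∃ m, RelWalk E m i j := by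
  constructor
  · intro h
    induction h with
    | refl => exact ⟨0, nil i⟩
    | tail _ e ih =>
      obtain ⟨m, hm⟩ := ih
      exact ⟨m + 1, hm.append (single e)⟩
  · rintro ⟨m, hm⟩
    induction hm with
    | nil i => exact .refl
    | cons e _ ih => exact .head e ih

theorem iff_iterate {τ : V → V} (hτ : ∀ i j, E i j ↔ j = τ i) (m : ℕ) (i j : V) :
    RelWalk E m i j ↔ j = τ^[m] i := by
  constructor
  · intro h
    induction h with
    | nil i => rfl
    | cons e _ ih => rw [ih, (hτ _ _).1 e, Function.iterate_succ_apply]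
  · rintro rfl
    simpa using of_fun (fun k => τ^[k] i) 0 m fun k _ =>
      (hτ _ _).2 (Function.iterate_succ_apply' τ k i)

end RelWalk

open Classical in
/-- The set of vertices strongly connected to `i`. -/
noncomputable def sccFinset {V : Type*} [Fintype V] (E : V → V → Prop) (i : V) : Finset V :=
  Finset.univ.filter fun j => Relation.ReflTransGen E i j ∧ Relation.ReflTransGen E j i

theorem mem_sccFinset {V : Type*} [Fintype V] {E : V → V → Prop} {i j : V} :
    j ∈ sccFinset E i ↔ Relation.ReflTransGen E i j ∧ Relation.ReflTransGen E j i := by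
  simp [sccFinset]

/-- `d` divides the length of every closed walk through `i`. -/
def IsPeriodAt {V : Type*} (E : V → V → Prop) (i : V) (d : ℕ) : Prop :=
  ∀ m, RelWalk E m i i → d ∣ m

namespace IsPeriodAt

variable {V : Type*} {E : V → V → Prop} {i : V} {d : ℕ}

theorem modEq (hd : IsPeriodAt E i d) {x : V} {a b : ℕ} (ha : RelWalk E a i x)
    (hb : RelWalk E b i x) (hx : Relation.ReflTransGen E x i) : a ≡ b [MOD d] := by
  obtain ⟨e, he⟩ := RelWalk.reflTransGen_iff.1 hx
  have h1 : a + e ≡ b + e [MOD d] :=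
    ((Nat.modEq_zero_iff_dvd.2 (hd _ (ha.append he))).trans
      (Nat.modEq_zero_iff_dvd.2 (hd _ (hb.append he))).symm)
  exact Nat.ModEq.add_right_cancel' e h1

/-- Along a closed walk through `i`, the first `d` vertices are distinct. -/
theorem exists_injOn [Fintype V] (hd : IsPeriodAt E i d) {L : ℕ} (hL : RelWalk E L i i)
    (hpos : 0 < L) : ∃ f : ℕ → V, (∀ k < d, RelWalk E k i (f k) ∧ f k ∈ sccFinset E i) ∧
      Set.InjOn f (Finset.range d) := by
  obtain ⟨f, h0, h1, hf⟩ := hL.exists_fun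
  have hdL : d ≤ L := Nat.le_of_dvd hpos (hd _ hL)
  have hw : ∀ k < d, RelWalk E k i (f k) := fun k hk => by
    simpa [h0] using RelWalk.of_fun f 0 k fun t ht => hf t (by omega)
  have hb : ∀ k < d, Relation.ReflTransGen E (f k) i := fun k hk => by
    have := RelWalk.of_fun f k (L - k) fun t ht => hf t (by omega)
    rw [Nat.add_sub_cancel' (by omega), h1] at this
    exact RelWalk.reflTransGen_iff.2 ⟨_, this⟩
  refine ⟨f, fun k hk => ⟨hw k hk, mem_sccFinset.2
    ⟨RelWalk.reflTransGen_iff.2 ⟨k, hw k hk⟩, hb k hk⟩⟩, fun a ha b hb' hab => ?_⟩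
  simp only [Finset.coe_range, Set.mem_Iio] at ha hb'
  exact (hd.modEq (hw a ha) (hab ▸ hw b hb') (hb a ha)).eq_of_lt_of_lt ha hb'

theorem le_card [Fintype V] (hd : IsPeriodAt E i d) {L : ℕ} (hL : RelWalk E L i i)
    (hpos : 0 < L) : d ≤ (sccFinset E i).card := by
  obtain ⟨f, hf, hinj⟩ := hd.exists_injOn hL hpos
  simpa using Finset.card_le_card_of_injOn f
    (fun k hk => (hf k (Finset.mem_range.1 hk)).2) hinj

theorem exists_walk_lt [Fintype V] (hd : IsPeriodAt E i d) {L : ℕ} (hL : RelWalk E L i i)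
    (hpos : 0 < L) (hcard : d = (sccFinset E i).card) :
    ∃ f : ℕ → V, ∀ x ∈ sccFinset E i, ∃ a < d, RelWalk E a i x ∧ f a = x := by
  classical
  obtain ⟨f, hf, hinj⟩ := hd.exists_injOn hL hpos
  refine ⟨f, fun x hx => ?_⟩
  have himg : (Finset.range d).image f = sccFinset E i := by
    refine Finset.eq_of_subset_of_card_le (fun y hy => ?_) ?_
    · obtain ⟨k, hk, rfl⟩ := Finset.mem_image.1 hy
      exact (hf k (Finset.mem_range.1 hk)).2
    · rw [Finset.card_image_of_injOn hinj, Finset.card_range, hcard]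
  rw [← himg] at hx
  obtain ⟨k, hk, rfl⟩ := Finset.mem_image.1 hx
  exact ⟨k, Finset.mem_range.1 hk, (hf k (Finset.mem_range.1 hk)).1, rfl⟩

/-- In a strong component as large as its period, each vertex has at most one successor. -/
theorem succ_unique [Fintype V] (hd : IsPeriodAt E i d) {L : ℕ} (hL : RelWalk E L i i)
    (hpos : 0 < L) (hcard : d = (sccFinset E i).card) {x y y' : V}
    (hx : x ∈ sccFinset E i) (hy : y ∈ sccFinset E i) (hy' : y' ∈ sccFinset E i)
    (e : E x y) (e' : E x y') : y = y' := by
  obtain ⟨f, hf⟩ := hd.exists_walk_lt hL hpos hcard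
  obtain ⟨a, -, ha, -⟩ := hf x hx
  obtain ⟨b, hb, hbw, rfl⟩ := hf y hy
  obtain ⟨b', hlt, hbw', rfl⟩ := hf y' hy'
  have h1 := hd.modEq (ha.append (.single e)) hbw (mem_sccFinset.1 hy).2
  have h2 := hd.modEq (ha.append (.single e')) hbw' (mem_sccFinset.1 hy').2
  rw [(h1.symm.trans h2).eq_of_lt_of_lt hb hlt]

/-- In a strong component as large as its period, each vertex has at most one predecessor. -/
theorem pred_unique [Fintype V] (hd : IsPeriodAt E i d) {L : ℕ} (hL : RelWalk E L i i)
    (hpos : 0 < L) (hcard : d = (sccFinset E i).card) {x x' y : V}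
    (hx : x ∈ sccFinset E i) (hx' : x' ∈ sccFinset E i) (hy : y ∈ sccFinset E i)
    (e : E x y) (e' : E x' y) : x = x' := by
  obtain ⟨f, hf⟩ := hd.exists_walk_lt hL hpos hcard
  obtain ⟨a, ha, haw, rfl⟩ := hf x hx
  obtain ⟨a', ha', haw', rfl⟩ := hf x' hx'
  have h1 := hd.modEq (haw.append (.single e)) (haw'.append (.single e')) (mem_sccFinset.1 hy).2
  rw [(Nat.ModEq.add_right_cancel' 1 h1).eq_of_lt_of_lt ha ha']

end IsPeriodAt

/-- `WeightedWalk A m i j w`: there is a walk of length `m` and weight `w` from `i` to `j`. -/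
inductive WeightedWalk {n : ℕ} (A : Fin n → Fin n → T) : ℕ → Fin n → Fin n → T → Prop
  | nil (i : Fin n) : WeightedWalk A 0 i i 0
  | cons {m : ℕ} {i j k : Fin n} {w : T} :
      WeightedWalk A m j k w → WeightedWalk A (m + 1) i k (A i j + w)

namespace WeightedWalk

variable {n : ℕ} {A : Fin n → Fin n → T}

theorem append {m m' : ℕ} {i j k : Fin n} {w w' : T} (h : WeightedWalk A m i j w)
    (h' : WeightedWalk A m' j k w') : WeightedWalk A (m + m') i k (w + w') := by
  induction h with
  | nil i => simpa using h'
  | @cons m i j l w _ ih =>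
    rw [Nat.add_right_comm, add_assoc (A i j)]
    exact cons (ih h')

theorem of_fun (f : ℕ → Fin n) (m : ℕ) :
    WeightedWalk A m (f 0) (f m) (∑ k ∈ Finset.range m, A (f k) (f (k + 1))) := by
  induction m generalizing f with
  | zero => exact nil _
  | succ m ih =>
    rw [Finset.sum_range_succ', add_comm (Finset.sum _ _)]
    exact cons (ih fun k => f (k + 1))

theorem exists_fun {m : ℕ} {i j : Fin n} {w : T} (h : WeightedWalk A m i j w) :
    ∃ f : ℕ → Fin n, f 0 = i ∧ f m = j ∧ ∑ k ∈ Finset.range m, A (f k) (f (k + 1)) = w := by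
  induction h with
  | nil i => exact ⟨fun _ => i, rfl, rfl, by simp⟩
  | @cons m i j k w _ ih =>
    obtain ⟨f, h0, hm, hf⟩ := ih
    refine ⟨fun t => Nat.casesOn t i f, rfl, hm, ?_⟩
    rw [Finset.sum_range_succ', add_comm]
    simp only [h0, hf, Nat.rec_zero]

end WeightedWalk

section Critical

variable {n : ℕ} {A : Fin n → Fin n → T} {r : ℝ}

theorem cwt_comp_val (A : Fin n → Fin n → T) {ℓ : ℕ} (f : ℕ → Fin n) (hf : f (ℓ + 1) = f 0) :
    cwt A (fun k : Fin (ℓ + 1) => f k) = ∑ k ∈ Finset.range (ℓ + 1), A (f k) (f (k + 1)) := by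
  rw [cwt, ← Fin.sum_univ_eq_sum_range fun k => A (f k) (f (k + 1))]
  refine Finset.sum_congr rfl fun k _ => ?_
  rw [Fin.val_add_one]
  split_ifs with hk
  · subst hk
    simp [hf]
  · rfl

theorem RhoEq.sum_le (h : RhoEq A r) (f : ℕ → Fin n) (m : ℕ) (hf : f m = f 0) :
    ∑ k ∈ Finset.range m, A (f k) (f (k + 1)) ≤ ((m * r : ℝ) : T) := by
  cases m with
  | zero => simp
  | succ ℓ =>
    rw [← cwt_comp_val A f hf]
    simpa using h.2 ℓ fun k => f k

theorem critArc_of_sum_eq {f : ℕ → Fin n} {m : ℕ} (hf : f m = f 0)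
    (hw : ∑ k ∈ Finset.range m, A (f k) (f (k + 1)) = ((m * r : ℝ) : T)) {k : ℕ} (hk : k < m) :
    CritArc A r (f k) (f (k + 1)) := by
  obtain ⟨ℓ, rfl⟩ : ∃ ℓ, m = ℓ + 1 := ⟨m - 1, by omega⟩
  refine ⟨ℓ, fun k => f k, ?_, ⟨k, hk⟩, rfl, ?_⟩
  · rw [cwt_comp_val A f hf, hw]
    simp
  · simp only [Fin.val_add_one]
    split_ifs with h
    · have hk' : k = ℓ := by simpa using congrArg Fin.val h
      rw [hk', hf]
    · rfl

/-- A critical circuit, read off from any of its positions. -/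
theorem exists_fun_of_cwt_eq {ℓ : ℕ} {c : Fin (ℓ + 1) → Fin n}
    (hc : cwt A c = ((((ℓ : ℝ) + 1) * r : ℝ) : T)) (k : Fin (ℓ + 1)) :
    ∃ f : ℕ → Fin n, f 0 = c k ∧ f 1 = c (k + 1) ∧ f (ℓ + 1) = f 0 ∧
      ∑ t ∈ Finset.range (ℓ + 1), A (f t) (f (t + 1)) = (((ℓ + 1 : ℕ) * r : ℝ) : T) := by
  have hsucc (t : ℕ) : Fin.ofNat (ℓ + 1) (t + 1) = Fin.ofNat (ℓ + 1) t + 1 := by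
    ext
    simp [Fin.val_add]
  refine ⟨fun t => c (k + Fin.ofNat (ℓ + 1) t), by simp, ?_, by simp, ?_⟩
  · simp only [hsucc 0, Fin.ofNat_zero, zero_add]
  · rw [Nat.cast_add_one, ← hc, cwt, ← Equiv.sum_comp (Equiv.addLeft k),
      ← Fin.sum_univ_eq_sum_range
        fun t => A (c (k + Fin.ofNat (ℓ + 1) t)) (c (k + Fin.ofNat (ℓ + 1) (t + 1)))]
    simp only [hsucc, Fin.ofNat_val_eq_self, Equiv.coe_addLeft, add_assoc]

theorem CritArc.exists_return {i j : Fin n} (h : CritArc A r i j) :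
    ∃ (m : ℕ) (w : T), WeightedWalk A m j i w ∧ A i j + w = (((m + 1 : ℕ) * r : ℝ) : T) := by
  obtain ⟨ℓ, c, hc, k, rfl, rfl⟩ := h
  obtain ⟨f, h0, h1, hl, hs⟩ := exists_fun_of_cwt_eq hc k
  have hw := WeightedWalk.of_fun (A := A) (fun t => f (t + 1)) ℓ
  simp only [zero_add, hl, h0, h1] at hw
  rw [Finset.sum_range_succ', add_comm, zero_add, h0, h1] at hs
  exact ⟨ℓ, _, hw, hs⟩

theorem exists_return_of_critArc {f : ℕ → Fin n} {m : ℕ}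
    (hf : ∀ k < m, CritArc A r (f k) (f (k + 1))) :
    ∃ (m' : ℕ) (w : T), WeightedWalk A m' (f m) (f 0) w ∧
      (∑ k ∈ Finset.range m, A (f k) (f (k + 1))) + w = (((m + m' : ℕ) * r : ℝ) : T) := by
  induction m with
  | zero => exact ⟨0, 0, .nil _, by simp⟩
  | succ m ih =>
    obtain ⟨m', w, hw, hs⟩ := ih fun k hk => hf k (by omega)
    obtain ⟨p, v, hv, ht⟩ := (hf m (by omega)).exists_return
    refine ⟨p + m', v + w, hv.append hw, ?_⟩
    rw [Finset.sum_range_succ, add_comm v w, add_add_add_comm, hs, ht, ← WithBot.coe_add]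
    congr 1
    push_cast
    ring

/-- A closed walk along critical arcs is a critical circuit. -/
theorem RhoEq.sum_eq_of_critArc (h : RhoEq A r) {f : ℕ → Fin n} {m : ℕ} (hm : f m = f 0)
    (hf : ∀ k < m, CritArc A r (f k) (f (k + 1))) :
    ∑ k ∈ Finset.range m, A (f k) (f (k + 1)) = ((m * r : ℝ) : T) := by
  obtain ⟨m', w, hw, hs⟩ := exists_return_of_critArc hf
  have h1 := h.sum_le f m hm
  have h2 : w ≤ ((m' * r : ℝ) : T) := by
    obtain ⟨g, g0, gm, rfl⟩ := hw.exists_fun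
    exact h.sum_le g m' (by rw [gm, g0, hm])
  generalize ∑ k ∈ Finset.range m, A (f k) (f (k + 1)) = s at *
  induction s using WithBot.recBotCoe with
  | bot => exact absurd hs.symm (by rw [WithBot.bot_add]; exact WithBot.coe_ne_bot)
  | coe s =>
    induction w using WithBot.recBotCoe with
    | bot => exact absurd hs.symm (by rw [WithBot.add_bot]; exact WithBot.coe_ne_bot)
    | coe w =>
      norm_cast at *
      push_cast at *
      linarith

theorem critArc_walk_of_cwt_eq {ℓ : ℕ} {c : Fin (ℓ + 1) → Fin n}
    (hc : cwt A c = ((((ℓ : ℝ) + 1) * r : ℝ) : T)) (k : Fin (ℓ + 1)) :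
    RelWalk (CritArc A r) (ℓ + 1) (c k) (c k) ∧
      RelWalk (CritArc A r) ℓ (c (k + 1)) (c k) := by
  obtain ⟨f, h0, h1, hl, hs⟩ := exists_fun_of_cwt_eq hc k
  have hf : ∀ t < ℓ + 1, CritArc A r (f t) (f (t + 1)) := fun t => critArc_of_sum_eq hl hs
  have hw := RelWalk.of_fun f 0 (ℓ + 1) fun t ht => hf t (by omega)
  have hw' := RelWalk.of_fun f 1 ℓ fun t ht => hf t (by omega)
  rw [zero_add, hl, h0] at hw
  rw [add_comm 1, hl, h0, h1] at hw'
  exact ⟨hw, hw'⟩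

theorem RhoEq.exists_cwt_eq_iff (h : RhoEq A r) (ℓ : ℕ) (i : Fin n) :
    (∃ c : Fin (ℓ + 1) → Fin n, cwt A c = ((((ℓ : ℝ) + 1) * r : ℝ) : T) ∧ c 0 = i) ↔
      RelWalk (CritArc A r) (ℓ + 1) i i := by
  constructor
  · rintro ⟨c, hc, rfl⟩
    exact (critArc_walk_of_cwt_eq hc 0).1
  · intro hw
    obtain ⟨f, h0, h1, hf⟩ := hw.exists_fun
    have hcl : f (ℓ + 1) = f 0 := by rw [h0, h1]
    refine ⟨fun k => f k, ?_, by simpa using h0⟩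
    rw [cwt_comp_val A f hcl, h.sum_eq_of_critArc hcl hf]
    simp

theorem RhoEq.cycAt_eq (h : RhoEq A r) (i : Fin n) :
    cycAt A r i = sSup {d | IsPeriodAt (CritArc A r) i d} := by
  unfold cycAt
  congr 1
  ext d
  simp only [Set.mem_ofPred_eq, h.exists_cwt_eq_iff, IsPeriodAt]
  refine ⟨fun hd m hm => ?_, fun hd ℓ hℓ => hd _ hℓ⟩
  cases m with
  | zero => simp
  | succ ℓ => exact hd ℓ hm

theorem CritNode.exists_walk {i : Fin n} (hi : CritNode A r i) :
    ∃ L, 0 < L ∧ RelWalk (CritArc A r) L i i := by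
  obtain ⟨ℓ, c, hc, k, rfl⟩ := hi
  exact ⟨ℓ + 1, by omega, (critArc_walk_of_cwt_eq hc k).1⟩

theorem CritNode.exists_critArc {i : Fin n} (hi : CritNode A r i) : ∃ j, CritArc A r i j := by
  obtain ⟨ℓ, c, hc, k, rfl⟩ := hi
  exact ⟨_, ℓ, c, hc, k, rfl, rfl⟩

theorem CritArc.critNode {i j : Fin n} (h : CritArc A r i j) : CritNode A r i := by
  obtain ⟨ℓ, c, hc, k, hk, -⟩ := h
  exact ⟨ℓ, c, hc, k, hk⟩

theorem CritArc.reflTransGen_symm {i j : Fin n} (h : CritArc A r i j) :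
    Relation.ReflTransGen (CritArc A r) j i := by
  obtain ⟨ℓ, c, hc, k, rfl, rfl⟩ := h
  exact RelWalk.reflTransGen_iff.2 ⟨ℓ, (critArc_walk_of_cwt_eq hc k).2⟩

theorem CritNode.bddAbove {i : Fin n} (hi : CritNode A r i) :
    BddAbove {d | IsPeriodAt (CritArc A r) i d} := by
  obtain ⟨L, hL, hw⟩ := hi.exists_walk
  exact ⟨L, fun d hd => Nat.le_of_dvd hL (hd _ hw)⟩

theorem RhoEq.isPeriodAt_cycAt (h : RhoEq A r) {i : Fin n} (hi : CritNode A r i) :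
    IsPeriodAt (CritArc A r) i (cycAt A r i) := by
  rw [h.cycAt_eq]
  have hone : IsPeriodAt (CritArc A r) i 1 := fun m _ => one_dvd m
  exact Nat.sSup_mem (s := {d | IsPeriodAt (CritArc A r) i d}) ⟨1, hone⟩ hi.bddAbove

theorem RhoEq.le_cycAt (h : RhoEq A r) {i : Fin n} (hi : CritNode A r i) {d : ℕ}
    (hd : IsPeriodAt (CritArc A r) i d) : d ≤ cycAt A r i := by
  rw [h.cycAt_eq]
  exact le_csSup hi.bddAbove hd

theorem RhoEq.cycAt_le_card (h : RhoEq A r) {i : Fin n} (hi : CritNode A r i) :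
    cycAt A r i ≤ (sccFinset (CritArc A r) i).card := by
  obtain ⟨L, hL, hw⟩ := hi.exists_walk
  exact (h.isPeriodAt_cycAt hi).le_card hw hL

theorem SccReps.pairwiseDisjoint {R : Finset (Fin n)} (hR : SccReps A r R) :
    (R : Set (Fin n)).PairwiseDisjoint (sccFinset (CritArc A r)) := by
  intro i hi j hj hij
  refine Finset.disjoint_left.2 fun x hx hx' => hR.2.1 i hi j hj hij ?_
  rw [mem_sccFinset] at hx hx'
  exact ⟨hx.1.trans hx'.2, hx'.1.trans hx.2⟩

theorem SccReps.sum_card_le {R : Finset (Fin n)} (hR : SccReps A r R) :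
    ∑ i ∈ R, (sccFinset (CritArc A r) i).card ≤ n := by
  rw [← Finset.card_biUnion hR.pairwiseDisjoint]
  simpa using Finset.card_le_univ (R.biUnion (sccFinset (CritArc A r)))

theorem exists_perm_of_sum_cycAt (h : RhoEq A r) {R : Finset (Fin n)} (hR : SccReps A r R)
    (hsum : ∑ i ∈ R, cycAt A r i = n) :
    ∃ τ : Equiv.Perm (Fin n), ∀ i j, CritArc A r i j ↔ j = τ i := by
  have hle : ∀ i ∈ R, cycAt A r i ≤ (sccFinset (CritArc A r) i).card :=
    fun i hi => h.cycAt_le_card (hR.1 i hi)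
  have hcard : ∑ i ∈ R, (sccFinset (CritArc A r) i).card = n :=
    le_antisymm hR.sum_card_le (hsum.symm.trans_le (Finset.sum_le_sum hle))
  have heq := (Finset.sum_eq_sum_iff_of_le hle).1 (hsum.trans hcard.symm)
  have huniv : R.biUnion (sccFinset (CritArc A r)) = Finset.univ := by
    rw [← Finset.card_eq_iff_eq_univ, Finset.card_biUnion hR.pairwiseDisjoint, hcard,
      Fintype.card_fin]
  have hcover : ∀ x, ∃ i ∈ R, x ∈ sccFinset (CritArc A r) i := fun x =>
    Finset.mem_biUnion.1 (huniv ▸ Finset.mem_univ x)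
  have hstep : ∀ {i x y}, CritArc A r x y →
      (x ∈ sccFinset (CritArc A r) i ↔ y ∈ sccFinset (CritArc A r) i) := fun {i x y} e => by
    simp only [mem_sccFinset]
    exact ⟨fun hx => ⟨hx.1.tail e, e.reflTransGen_symm.trans hx.2⟩,
      fun hy => ⟨hy.1.trans e.reflTransGen_symm, .head e hy.2⟩⟩
  have hsucc : ∀ x, ∃ y, CritArc A r x y := fun x => by
    obtain ⟨i, hi, hx⟩ := hcover x
    obtain ⟨y, hy⟩ := (hR.1 i hi).exists_critArc
    rcases (mem_sccFinset.1 hx).2.cases_head with rfl | ⟨z, hz, -⟩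
    exacts [⟨y, hy⟩, ⟨z, hz⟩]
  choose t ht using hsucc
  have hinj : Function.Injective t := fun x x' hxx => by
    obtain ⟨i, hi, hx⟩ := hcover x
    obtain ⟨L, hL, hw⟩ := (hR.1 i hi).exists_walk
    have hy := (hstep (ht x)).1 hx
    have e' : CritArc A r x' (t x) := hxx ▸ ht x'
    exact (h.isPeriodAt_cycAt (hR.1 i hi)).pred_unique hw hL (heq i hi) hx
      ((hstep e').2 hy) hy (ht x) e'
  refine ⟨Equiv.ofBijective t (Finite.injective_iff_bijective.1 hinj), fun x y => ?_⟩
  rw [Equiv.ofBijective_apply]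
  refine ⟨fun e => ?_, fun hy => hy ▸ ht x⟩
  obtain ⟨i, hi, hx⟩ := hcover x
  obtain ⟨L, hL, hw⟩ := (hR.1 i hi).exists_walk
  exact (h.isPeriodAt_cycAt (hR.1 i hi)).succ_unique hw hL (heq i hi) hx
    ((hstep e).1 hx) ((hstep (ht x)).1 hx) e (ht x)

theorem Equiv.Perm.iterate_orderOf_apply {α : Type*} (σ : Equiv.Perm α) (i : α) :
    σ^[orderOf σ] i = i := by
  rw [← Equiv.Perm.coe_pow, pow_orderOf_eq_one, Equiv.Perm.one_apply]

theorem sum_cycAt_of_perm (h : RhoEq A r) {R : Finset (Fin n)} (hR : SccReps A r R)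
    {τ : Equiv.Perm (Fin n)} (hτ : ∀ i j, CritArc A r i j ↔ j = τ i) :
    ∑ i ∈ R, cycAt A r i = n := by
  have hwalk := RelWalk.iff_iterate hτ
  have hle : ∀ i ∈ R, (sccFinset (CritArc A r) i).card ≤ cycAt A r i := fun i hi => by
    set p := Function.minimalPeriod τ i with hp
    have hpos : 0 < p := Function.IsPeriodicPt.minimalPeriod_pos (orderOf_pos τ)
      (τ.iterate_orderOf_apply i)
    have hper : IsPeriodAt (CritArc A r) i p := fun m hm =>
      Function.IsPeriodicPt.minimalPeriod_dvd ((hwalk m i i).1 hm).symm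
    refine le_trans ?_ (h.le_cycAt (hR.1 i hi) hper)
    have hsub : sccFinset (CritArc A r) i ⊆ (Finset.range p).image fun k => τ^[k] i := by
      intro x hx
      obtain ⟨m, hm⟩ := RelWalk.reflTransGen_iff.1 (mem_sccFinset.1 hx).1
      rw [hwalk] at hm
      exact Finset.mem_image.2 ⟨m % p, Finset.mem_range.2 (Nat.mod_lt _ hpos),
        by rw [hm, hp, Function.iterate_mod_minimalPeriod_eq]⟩
    simpa using (Finset.card_le_card hsub).trans Finset.card_image_le
  have huniv : R.biUnion (sccFinset (CritArc A r)) = Finset.univ := by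
    refine Finset.eq_univ_of_forall fun x => ?_
    obtain ⟨i, hi, hx⟩ := hR.2.2 x ((hτ x _).2 rfl).critNode
    exact Finset.mem_biUnion.2 ⟨i, hi, mem_sccFinset.2 hx⟩
  have hcard : ∑ i ∈ R, (sccFinset (CritArc A r) i).card = n := by
    rw [← Finset.card_biUnion hR.pairwiseDisjoint, huniv, Finset.card_univ, Fintype.card_fin]
  refine (Finset.sum_congr rfl fun i hi => ?_).trans hcard
  exact le_antisymm (h.cycAt_le_card (hR.1 i hi)) (hle i hi)

theorem sum_sum_iterate_perm {σ : Equiv.Perm (Fin n)} (a : Fin n → ℝ) (N : ℕ) :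
    ∑ i, ∑ k ∈ Finset.range N, a (σ^[k] i) = N * ∑ i, a i := by
  rw [Finset.sum_comm]
  have : ∀ k ∈ Finset.range N, ∑ i, a (σ^[k] i) = ∑ i, a i := fun k _ => by
    simpa only [Equiv.Perm.coe_pow] using Equiv.sum_comp (σ ^ k) a
  rw [Finset.sum_congr rfl this]
  simp

theorem exists_real_of_wt_ne_bot {σ : Equiv.Perm (Fin n)} (hσ : wt A σ ≠ ⊥) :
    ∃ a : Fin n → ℝ, ∀ i, A i (σ i) = a i := by
  have hne : ∀ i, A i (σ i) ≠ ⊥ := fun i hi =>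
    hσ (WithBot.sum_eq_bot_iff.2 ⟨i, Finset.mem_univ i, hi⟩)
  exact ⟨fun i => (A i (σ i)).unbot (hne i), fun i => (WithBot.coe_unbot _ _).symm⟩

theorem sum_iterate_eq_coe {σ : Equiv.Perm (Fin n)} {a : Fin n → ℝ}
    (ha : ∀ i, A i (σ i) = a i) (N : ℕ) (i : Fin n) :
    ∑ k ∈ Finset.range N, A (σ^[k] i) (σ^[k + 1] i)
      = ((∑ k ∈ Finset.range N, a (σ^[k] i) : ℝ) : T) := by
  simp only [Function.iterate_succ_apply', ha, WithBot.coe_sum]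

theorem RhoEq.sum_iterate_le (h : RhoEq A r) {σ : Equiv.Perm (Fin n)} {a : Fin n → ℝ}
    (ha : ∀ i, A i (σ i) = a i) (i : Fin n) :
    ∑ k ∈ Finset.range (orderOf σ), a (σ^[k] i) ≤ orderOf σ * r := by
  have := h.sum_le (fun k => σ^[k] i) (orderOf σ) (σ.iterate_orderOf_apply i)
  rw [sum_iterate_eq_coe ha] at this
  exact_mod_cast this

theorem wt_eq_coe {σ : Equiv.Perm (Fin n)} {a : Fin n → ℝ} (ha : ∀ i, A i (σ i) = a i) :
    wt A σ = ((∑ i, a i : ℝ) : T) := by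
  simp only [wt, ha, WithBot.coe_sum]

theorem RhoEq.wt_le (h : RhoEq A r) (σ : Equiv.Perm (Fin n)) :
    wt A σ ≤ ((n * r : ℝ) : T) := by
  by_cases hσ : wt A σ = ⊥
  · simp [hσ]
  obtain ⟨a, ha⟩ := exists_real_of_wt_ne_bot hσ
  rw [wt_eq_coe ha, WithBot.coe_le_coe]
  have hN : (0 : ℝ) < orderOf σ := by exact_mod_cast orderOf_pos σ
  have hle := Finset.sum_le_sum fun i (_ : i ∈ Finset.univ) => h.sum_iterate_le ha i
  rw [sum_sum_iterate_perm] at hle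
  simp only [Finset.sum_const, Finset.card_univ, Fintype.card_fin, nsmul_eq_mul] at hle
  rw [mul_left_comm] at hle
  exact le_of_mul_le_mul_left hle hN

theorem RhoEq.critArc_of_wt_eq (h : RhoEq A r) {σ : Equiv.Perm (Fin n)}
    (hσ : wt A σ = ((n * r : ℝ) : T)) (i : Fin n) : CritArc A r i (σ i) := by
  obtain ⟨a, ha⟩ := exists_real_of_wt_ne_bot (hσ ▸ WithBot.coe_ne_bot)
  rw [wt_eq_coe ha, WithBot.coe_inj] at hσ
  have hsum : ∑ i, ∑ k ∈ Finset.range (orderOf σ), a (σ^[k] i)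
      = ∑ _i : Fin n, (orderOf σ * r : ℝ) := by
    rw [sum_sum_iterate_perm, hσ]
    simp only [Finset.sum_const, Finset.card_univ, Fintype.card_fin, nsmul_eq_mul]
    ring
  have heq := (Finset.sum_eq_sum_iff_of_le fun i _ => h.sum_iterate_le ha i).1 hsum i
    (Finset.mem_univ i)
  exact critArc_of_sum_eq (f := fun k => σ^[k] i) (σ.iterate_orderOf_apply i)
    (by rw [sum_iterate_eq_coe ha, heq]) (orderOf_pos σ)

theorem CritArc.ne_bot {i j : Fin n} (h : CritArc A r i j) : A i j ≠ ⊥ := by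
  obtain ⟨m, w, -, hs⟩ := h.exists_return
  intro hb
  rw [hb, WithBot.bot_add] at hs
  exact WithBot.coe_ne_bot hs.symm

theorem RhoEq.wt_eq_of_critArc (h : RhoEq A r) {σ : Equiv.Perm (Fin n)}
    (hσ : ∀ i, CritArc A r i (σ i)) : wt A σ = ((n * r : ℝ) : T) := by
  have hne : wt A σ ≠ ⊥ := fun hb => by
    obtain ⟨i, -, hi⟩ := WithBot.sum_eq_bot_iff.1 hb
    exact (hσ i).ne_bot hi
  obtain ⟨a, ha⟩ := exists_real_of_wt_ne_bot hne
  rw [wt_eq_coe ha, WithBot.coe_inj]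
  have heq : ∀ i, ∑ k ∈ Finset.range (orderOf σ), a (σ^[k] i) = orderOf σ * r := fun i => by
    have := h.sum_eq_of_critArc (f := fun k => σ^[k] i) (σ.iterate_orderOf_apply i)
      fun k _ => by simpa only [Function.iterate_succ_apply'] using hσ (σ^[k] i)
    rw [sum_iterate_eq_coe ha] at this
    exact_mod_cast this
  have hN : (orderOf σ : ℝ) ≠ 0 := by exact_mod_cast (orderOf_pos σ).ne'
  have hsum := sum_sum_iterate_perm (σ := σ) a (orderOf σ)
  simp only [heq, Finset.sum_const, Finset.card_univ, Fintype.card_fin, nsmul_eq_mul] at hsum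
  rw [mul_left_comm] at hsum
  exact (mul_left_cancel₀ hN hsum).symm

end Critical

/-- Maximal ultimate rank criterion: `urk(A) = n` iff the critical graph
is the disjoint union of simple circuits covering all nodes (i.e. the graph of a
permutation); in this case `per(A) = n·ρ(A)` and `A` has a unique maximizing permutation
whose graph is the critical graph. -/
theorem stmt15 {n : ℕ} (A : Fin n → Fin n → T) (r : ℝ) (h : RhoEq A r)
    (R : Finset (Fin n)) (hR : SccReps A r R) :
    ((∑ i ∈ R, cycAt A r i) = n ↔
      ∃ τ : Equiv.Perm (Fin n), ∀ i j, CritArc A r i j ↔ j = τ i) ∧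
    ((∑ i ∈ R, cycAt A r i) = n →
      per A = (((n : ℝ) * r : ℝ) : T) ∧
      (∃! σ : Equiv.Perm (Fin n), wt A σ = per A) ∧
      (∀ σ : Equiv.Perm (Fin n), wt A σ = per A →
        ∀ i j, CritArc A r i j ↔ σ i = j)) := by
  refine ⟨⟨exists_perm_of_sum_cycAt h hR, fun ⟨τ, hτ⟩ => sum_cycAt_of_perm h hR hτ⟩,
    fun hsum => ?_⟩
  obtain ⟨τ, hτ⟩ := exists_perm_of_sum_cycAt h hR hsum
  have hwt : wt A τ = ((n * r : ℝ) : T) := h.wt_eq_of_critArc fun i => (hτ i _).2 rfl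
  have hper : per A = ((n * r : ℝ) : T) :=
    le_antisymm (Finset.sup_le fun σ _ => h.wt_le σ)
      (hwt ▸ Finset.le_sup (f := fun σ => wt A σ) (Finset.mem_univ τ))
  have huniq : ∀ σ : Equiv.Perm (Fin n), wt A σ = per A → σ = τ := fun σ hσ =>
    Equiv.ext fun i => (hτ i _).1 (h.critArc_of_wt_eq (hσ.trans hper) i)
  refine ⟨hper, ⟨τ, hwt.trans hper.symm, huniq⟩, fun σ hσ i j => ?_⟩
  rw [huniq σ hσ, hτ, eq_comm]
end
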